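/- For all m, n ≥ 2, the complete bipartite graph K_{m,n} admits no topological integer additive set-graceful labeling with respect to any ground set X with |X| ≥ 2. -/

import Mathlib

open Finset Pointwise

/-- `f` is an integer additive set-graceful labeling (IASGL) of `G` with respect to the
ground set `X`: `f` is injective, assigns nonempty subsets of `X` to vertices, the induced
edge function `f⁺(uv) = f u + f v` (sumset) is injective on edges, and its image is exactly
the collection of subsets of `X` other than `∅` and `{0}`. -/
def IsIASGL {V : Type*} (G : SimpleGraph V) (X : Finset ℕ) (f : V → Finset ℕ) : Prop :=
  Function.Injective f ∧
  (∀ v, (f v).Nonempty ∧ f v ⊆ X) ∧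
  (∀ u v u' v', G.Adj u v → G.Adj u' v' → f u + f v = f u' + f v' → s(u, v) = s(u', v')) ∧
  (∀ A : Finset ℕ, (∃ u v, G.Adj u v ∧ f u + f v = A) ↔ A ⊆ X ∧ A.Nonempty ∧ A ≠ {0})

/-- `T` is a topology on the finite ground set `X`: a family of subsets of `X`
containing `∅` and `X` and closed under pairwise unions and intersections. -/
def IsTopologyFamily (X : Finset ℕ) (T : Set (Finset ℕ)) : Prop :=
  (∀ A ∈ T, A ⊆ X) ∧ (∅ : Finset ℕ) ∈ T ∧ X ∈ T ∧
  (∀ A ∈ T, ∀ B ∈ T, A ∪ B ∈ T) ∧ (∀ A ∈ T, ∀ B ∈ T, A ∩ B ∈ T)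

/-- `f` is a topological integer additive set-labeling (Top-IASL) of `G` w.r.t. `X`. -/
def IsTopIASL {V : Type*} (G : SimpleGraph V) (X : Finset ℕ) (f : V → Finset ℕ) : Prop :=
  Function.Injective f ∧
  (∀ v, (f v).Nonempty ∧ f v ⊆ X) ∧
  (∀ u v, G.Adj u v → f u + f v ⊆ X) ∧
  IsTopologyFamily X (insert ∅ (Set.range f))

/-- `f` is a topological integer additive set-graceful labeling (Top-IASGL) of `G`. -/
def IsTopIASGL {V : Type*} (G : SimpleGraph V) (X : Finset ℕ) (f : V → Finset ℕ) : Prop :=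
  IsIASGL G X f ∧ IsTopologyFamily X (insert ∅ (Set.range f))

/-- A nonempty finite set `A` of naturals that translates a nonempty finite set `X` into itself
is `{0}`. -/
lemma eq_singleton_zero_of_add_subset_self {X A : Finset ℕ} (hX : X.Nonempty)
    (hA : A.Nonempty) (h : X + A ⊆ X) : A = {0} := by
  refine Finset.eq_singleton_iff_nonempty_unique_mem.2 ⟨hA, fun a ha => ?_⟩
  have := Finset.le_max' X _ (h (Finset.add_mem_add (X.max'_mem hX) ha))
  omega

/-- In a topological IASGL, a vertex labeled by the whole ground set has at most one neighbor. -/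
lemma IsTopIASGL.neighbor_unique {V : Type*} {G : SimpleGraph V} {X : Finset ℕ}
    {f : V → Finset ℕ} (hf : IsTopIASGL G X f) (hX : X.Nonempty) {v u w : V} (hv : f v = X)
    (hu : G.Adj v u) (hw : G.Adj v w) : u = w := by
  obtain ⟨⟨hinj, hne, -, himg⟩, -⟩ := hf
  have key (x : V) (hx : G.Adj v x) : f x = {0} := by
    refine eq_singleton_zero_of_add_subset_self hX (hne x).1 ?_
    have := ((himg _).1 ⟨v, x, hx, rfl⟩).1
    rwa [hv] at this
  exact hinj ((key u hu).trans (key w hw).symm)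

/-- In a topological IASGL, some vertex is labeled by the whole ground set. -/
lemma IsTopIASGL.exists_eq_ground {V : Type*} {G : SimpleGraph V} {X : Finset ℕ}
    {f : V → Finset ℕ} (hf : IsTopIASGL G X f) (hX : X.Nonempty) : ∃ v, f v = X :=
  hf.2.2.2.1.resolve_left hX.ne_empty

theorem stmt_18 (m n : ℕ) (hm : 2 ≤ m) (hn : 2 ≤ n) (X : Finset ℕ) (hX : 2 ≤ X.card) :
    ¬ ∃ f : Fin m ⊕ Fin n → Finset ℕ,
        IsTopIASGL (completeBipartiteGraph (Fin m) (Fin n)) X f := by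
  rintro ⟨f, hf⟩
  have hne : X.Nonempty := Finset.card_pos.1 (by omega)
  obtain ⟨v | v, hv⟩ := hf.exists_eq_ground hne
  · have := hf.neighbor_unique hne (u := Sum.inr ⟨0, by omega⟩) (w := Sum.inr ⟨1, by omega⟩) hv
      (by simp) (by simp)
    simp at this
  · have := hf.neighbor_unique hne (u := Sum.inl ⟨0, by omega⟩) (w := Sum.inl ⟨1, by omega⟩) hv
      (by simp) (by simp)
    simp at this
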